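/- There exists a unique function P̄(x₀,δ), analytic in x₀ at x₀ = 0 with P̄(0,δ) = 0 and ∂P̄/∂x₀(0,δ) > 0, such that, when n is odd, P(x₀,δ) = P̄(x₀,δ) for all sufficiently small |x₀| (both signs of x₀); in particular, for n odd the Poincaré return map P(·,δ) is analytic at x₀ = 0. -/

import Mathlib

open Set Filter Metric

section PolarBlowUp

open Topology BoundedContinuousFunction

/-- The multilinear map on bounded continuous functions induced by pointwise application. -/
noncomputable def ContinuousMultilinearMap.boundedSuperposition {E F : Type*}
    [NormedAddCommGroup E] [NormedSpace ℝ E] [NormedAddCommGroup F] [NormedSpace ℝ F] {k : ℕ}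
    (p : ContinuousMultilinearMap ℝ (fun _ : Fin k => E) F) :
    ContinuousMultilinearMap ℝ (fun _ : Fin k => ℝ →ᵇ E) (ℝ →ᵇ F) :=
  MultilinearMap.mkContinuous
    { toFun := fun u => BoundedContinuousFunction.ofNormedAddCommGroup
        (fun s => p fun i => u i s) (by fun_prop) (‖p‖ * ∏ i, ‖u i‖) (fun s =>
          (p.le_opNorm _).trans (by gcongr with i; exact (u i).norm_coe_le_norm s))
      map_update_add' := by
        intro _ m i x y
        ext s
        have h : ∀ z : ℝ →ᵇ E, (fun j => (Function.update m i z) j s)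
            = Function.update (fun j => m j s) i (z s) := by
          intro z; ext j; by_cases hj : j = i
          · subst hj; simp
          · simp [hj]
        simp [h]
      map_update_smul' := by
        intro _ m i c x
        ext s
        have h : ∀ z : ℝ →ᵇ E, (fun j => (Function.update m i z) j s)
            = Function.update (fun j => m j s) i (z s) := by
          intro z; ext j; by_cases hj : j = i
          · subst hj; simp
          · simp [hj]
        simp [h] } ‖p‖ (fun u =>
        (BoundedContinuousFunction.norm_le (by positivity)).2 fun s =>
          (p.le_opNorm _).trans (by gcongr with i; exact (u i).norm_coe_le_norm s))

theorem ContinuousMultilinearMap.norm_boundedSuperposition_le {E F : Type*}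
    [NormedAddCommGroup E] [NormedSpace ℝ E] [NormedAddCommGroup F] [NormedSpace ℝ F] {k : ℕ}
    (p : ContinuousMultilinearMap ℝ (fun _ : Fin k => E) F) :
    ‖p.boundedSuperposition‖ ≤ ‖p‖ := by
  unfold boundedSuperposition
  exact MultilinearMap.mkContinuous_norm_le _ (norm_nonneg _) _

/-- An analytic germ acts analytically, by composition, on small bounded continuous functions. -/
theorem exists_superposition {E F : Type*}
    [NormedAddCommGroup E] [NormedSpace ℝ E] [NormedAddCommGroup F] [NormedSpace ℝ F]
    [CompleteSpace F] {f : E → F} (hf : AnalyticAt ℝ f 0) :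
    ∃ N : (ℝ →ᵇ E) → (ℝ →ᵇ F), AnalyticAt ℝ N 0 ∧
      ∀ᶠ u in 𝓝 (0 : ℝ →ᵇ E), ∀ s, N u s = f (u s) := by
  obtain ⟨p, r, hp⟩ := hf
  let q : FormalMultilinearSeries ℝ (ℝ →ᵇ E) (ℝ →ᵇ F) := fun k => (p k).boundedSuperposition
  have hq : ∀ k, ‖q k‖ ≤ ‖p k‖ := fun k =>
    ContinuousMultilinearMap.norm_boundedSuperposition_le (p k)
  have hrad : p.radius ≤ q.radius := by
    refine ENNReal.le_of_forall_nnreal_lt fun t ht => ?_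
    obtain ⟨C, -, hC⟩ := p.norm_mul_pow_le_of_lt_radius ht
    exact q.le_radius_of_bound C fun k => (by gcongr; exact hq k : _ ≤ _).trans (hC k)
  have hq0 : 0 < q.radius := (hp.r_pos.trans_le hp.r_le).trans_le hrad
  have hs := q.hasFPowerSeriesOnBall hq0
  refine ⟨q.sum, hs.analyticAt, ?_⟩
  filter_upwards [Metric.eball_mem_nhds (0 : ℝ →ᵇ E) hp.r_pos] with u hu s
  have hu' : u ∈ Metric.eball (0 : ℝ →ᵇ E) q.radius :=
    Metric.eball_subset_eball (hp.r_le.trans hrad) hu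
  have h1 := hs.hasSum hu'
  rw [zero_add] at h1
  have hus : u s ∈ Metric.eball (0 : E) r := by
    rw [mem_eball_zero_iff] at hu ⊢
    refine lt_of_le_of_lt ?_ hu
    exact enorm_le_iff_norm_le.2 (u.norm_coe_le_norm s)
  have h2 := hp.hasSum hus
  rw [zero_add] at h2
  exact (h1.mapL (BoundedContinuousFunction.evalCLM ℝ s)).unique (by simpa [q] using! h2)

/-- Pairing of bounded continuous functions. -/
noncomputable def pairL : (ℝ →ᵇ ℝ) × (ℝ →ᵇ ℝ) →L[ℝ] (ℝ →ᵇ ℝ × ℝ) :=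
  (ContinuousLinearMap.compLeftContinuousBounded ℝ (.inl ℝ ℝ ℝ)).comp (.fst ℝ _ _) +
  (ContinuousLinearMap.compLeftContinuousBounded ℝ (.inr ℝ ℝ ℝ)).comp (.snd ℝ _ _)

theorem pairL_apply (u v : ℝ →ᵇ ℝ) (s : ℝ) : pairL (u, v) s = (u s, v s) := by
  simp [pairL]

theorem exists_superposition₂ {f : ℝ × ℝ → ℝ} (hf : AnalyticAt ℝ f 0) :
    ∃ N : (ℝ →ᵇ ℝ) × (ℝ →ᵇ ℝ) → (ℝ →ᵇ ℝ), AnalyticAt ℝ N 0 ∧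
      ∀ᶠ u in 𝓝 (0 : (ℝ →ᵇ ℝ) × (ℝ →ᵇ ℝ)), ∀ s, N u s = f (u.1 s, u.2 s) := by
  obtain ⟨N, hN, h⟩ := exists_superposition hf
  refine ⟨fun u => N (pairL u), ?_, ?_⟩
  · exact AnalyticAt.fun_comp (by simpa using hN) (pairL.analyticAt 0)
  · have : Tendsto pairL (𝓝 0) (𝓝 0) := by simpa using pairL.continuous.tendsto 0
    filter_upwards [this.eventually h] with u hu s
    rw [hu s, ← pairL_apply]

/-- The identity of `ℝ`, truncated to `[a, b]`. -/
noncomputable def clampL (a b : ℝ) : ℝ →ᵇ ℝ :=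
  BoundedContinuousFunction.ofNormedAddCommGroup (fun s => max a (min b s))
    (by fun_prop) (|a| + |b|) (fun s => by
      rw [Real.norm_eq_abs, abs_le]
      have := neg_abs_le a; have := le_abs_self a; have := neg_abs_le b; have := le_abs_self b
      have := abs_nonneg a; have := abs_nonneg b
      constructor
      · exact le_max_of_le_left (by linarith)
      · exact max_le (by linarith) (by linarith [min_le_left b s]))

theorem clampL_apply {a b s : ℝ} (hs : s ∈ Icc a b) : clampL a b s = s := by
  simp [clampL, hs.1, hs.2]

theorem norm_integral_clampL_le (a b : ℝ) (u : ℝ →ᵇ ℝ) (θ : ℝ) :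
    ‖∫ s in (0:ℝ)..(clampL a b θ), u s‖ ≤ ‖clampL a b‖ * ‖u‖ := by
  refine (intervalIntegral.norm_integral_le_of_norm_le_const
    (fun s _ => u.norm_coe_le_norm s)).trans ?_
  rw [mul_comm, sub_zero]
  gcongr
  exact (clampL a b).norm_coe_le_norm θ

/-- The primitive `θ ↦ ∫ s in 0..θ, u s`, constant outside `[a, b]`, as a bounded operator. -/
noncomputable def primL (a b : ℝ) : (ℝ →ᵇ ℝ) →L[ℝ] (ℝ →ᵇ ℝ) :=
  LinearMap.mkContinuous
    { toFun := fun u => BoundedContinuousFunction.ofNormedAddCommGroup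
        (fun θ => ∫ s in (0:ℝ)..(clampL a b θ), u s)
        ((intervalIntegral.continuous_primitive
          (fun _ _ => u.continuous.intervalIntegrable _ _) 0).comp (clampL a b).continuous)
        (‖clampL a b‖ * ‖u‖)
        (norm_integral_clampL_le a b u)
      map_add' := fun u v => by
        ext θ
        simp [intervalIntegral.integral_add (u.continuous.intervalIntegrable _ _)
          (v.continuous.intervalIntegrable _ _)]
      map_smul' := fun c u => by
        ext θ
        simp } ‖clampL a b‖ fun u =>
        (BoundedContinuousFunction.norm_le (by positivity)).2 (norm_integral_clampL_le a b u)

theorem primL_apply {a b θ : ℝ} (hθ : θ ∈ Icc a b) (u : ℝ →ᵇ ℝ) :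
    primL a b u θ = ∫ s in (0:ℝ)..θ, u s := by
  change (∫ s in (0:ℝ)..(clampL a b θ), u s) = _
  rw [clampL_apply hθ]

/-- Hadamard's lemma for analytic germs vanishing on the first coordinate axis. -/
theorem exists_eq_snd_mul_of_analyticAt {G : ℝ × ℝ → ℝ} (hG : AnalyticAt ℝ G 0)
    (h0 : ∀ᶠ x in 𝓝 (0:ℝ), G (x, 0) = 0) :
    ∃ H : ℝ × ℝ → ℝ, AnalyticAt ℝ H 0 ∧ ∀ᶠ p in 𝓝 (0 : ℝ × ℝ), G p = p.2 * H p := by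
  obtain ⟨N, hN, hN'⟩ := exists_superposition₂ (f := fun p => fderiv ℝ G p (0, 1))
    ((ContinuousLinearMap.apply ℝ ℝ ((0, 1) : ℝ × ℝ)).analyticAt _ |>.fun_comp hG.fderiv)
  let L : ℝ × ℝ → (ℝ →ᵇ ℝ) × (ℝ →ᵇ ℝ) := fun p => (p.1 • 1, p.2 • clampL 0 1)
  have hL : AnalyticAt ℝ L 0 :=
    (analyticAt_fst.smul analyticAt_const).prod (analyticAt_snd.smul analyticAt_const)
  have hL0 : L 0 = 0 := by simp [L]
  have hLt : Tendsto L (𝓝 0) (𝓝 0) := by simpa [hL0] using hL.continuousAt.tendsto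
  refine ⟨fun p => BoundedContinuousFunction.evalCLM ℝ 1 (primL 0 1 (N (L p))), ?_, ?_⟩
  · have h1 : AnalyticAt ℝ (fun p => N (L p)) 0 := AnalyticAt.fun_comp (by rwa [hL0]) hL
    exact (ContinuousLinearMap.analyticAt _ _).fun_comp
      ((ContinuousLinearMap.analyticAt _ _).fun_comp h1)
  · obtain ⟨ε, hε, hball⟩ := Metric.eventually_nhds_iff_ball.1 hG.eventually_analyticAt
    filter_upwards [hLt.eventually hN', Metric.ball_mem_nhds _ hε,
      (continuous_fst.tendsto' (0 : ℝ × ℝ) 0 rfl).eventually h0] with p hp hpε hp0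
    have hev : BoundedContinuousFunction.evalCLM ℝ 1 (primL 0 1 (N (L p)))
        = ∫ s in (0:ℝ)..1, (N (L p)) s := primL_apply (by simp) _
    have hmem : ∀ t ∈ Icc (0:ℝ) 1, (p.1, t * p.2) ∈ Metric.ball (0 : ℝ × ℝ) ε := by
      intro t ht
      rw [mem_ball_zero_iff, Prod.norm_def] at hpε ⊢
      refine lt_of_le_of_lt ?_ hpε
      gcongr
      rw [norm_mul, Real.norm_of_nonneg ht.1]
      exact mul_le_of_le_one_left (norm_nonneg _) ht.2
    have hd : ∀ t ∈ uIcc (0:ℝ) 1, HasDerivAt (fun t => G (p.1, t * p.2))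
        (p.2 * (N (L p)) t) t := by
      intro t ht
      rw [uIcc_of_le zero_le_one] at ht
      have h1 := (hball _ (hmem t ht)).differentiableAt.hasFDerivAt
      have h2 : HasDerivAt (fun t : ℝ => (p.1, t * p.2)) (0, 1 * p.2) t :=
        (hasDerivAt_const t p.1).prodMk ((hasDerivAt_id t).mul_const p.2)
      have h3 := h1.comp_hasDerivAt t h2
      have h4 : (N (L p)) t = fderiv ℝ G (p.1, t * p.2) (0, 1) := by
        rw [hp t]
        simp [L, clampL_apply ht, mul_comm]
      rw [h4, ← smul_eq_mul, ← map_smul]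
      simpa [Function.comp_def] using! h3
    have := intervalIntegral.integral_eq_sub_of_hasDerivAt hd
      (Continuous.intervalIntegrable (by fun_prop) _ _)
    rw [intervalIntegral.integral_const_mul] at this
    rw [hev, this]
    simp [hp0]

theorem exp_apply_bcf (u : ℝ →ᵇ ℝ) (s : ℝ) : NormedSpace.exp u s = Real.exp (u s) := by
  have h := NormedSpace.map_exp (F := (ℝ →ᵇ ℝ) →ₐ[ℝ] ℝ)
    ((Pi.evalAlgHom ℝ (fun _ : ℝ => ℝ) s).comp
      ((ContinuousMap.coeFnAlgHom ℝ).comp (BoundedContinuousFunction.toContinuousMapₐ ℝ)))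
    (BoundedContinuousFunction.evalCLM ℝ s).continuous u
  rw [Real.exp_eq_exp_ℝ]
  exact h

open scoped ContDiff in
/-- The solution of `Λ = I (R (z • exp Λ))` given by the implicit function theorem depends
analytically on `z`. -/
theorem exists_analytic_fixed (I : (ℝ →ᵇ ℝ) →L[ℝ] (ℝ →ᵇ ℝ)) {R : (ℝ →ᵇ ℝ) → (ℝ →ᵇ ℝ)}
    (hR : AnalyticAt ℝ R 0) :
    ∃ Λ : ℝ → (ℝ →ᵇ ℝ), AnalyticAt ℝ Λ 0 ∧
      ∀ᶠ z in 𝓝 (0 : ℝ), Λ z = I (R (z • NormedSpace.exp (Λ z))) := by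
  set w₀ := I (R 0) with hw₀
  let E : ℝ × (ℝ →ᵇ ℝ) → (ℝ →ᵇ ℝ) := fun p => p.1 • NormedSpace.exp p.2
  have hE : AnalyticAt ℝ E (0, w₀) :=
    analyticAt_fst.smul (AnalyticAt.fun_comp (f := Prod.snd) (x := ((0 : ℝ), w₀))
      (NormedSpace.exp_analytic (𝕂 := ℝ) w₀) analyticAt_snd)
  have hE0 : E (0, w₀) = 0 := by simp [E]
  have hRE : AnalyticAt ℝ (fun p => R (E p)) (0, w₀) := AnalyticAt.fun_comp (by rwa [hE0]) hE
  let Φ : ℝ × (ℝ →ᵇ ℝ) → (ℝ →ᵇ ℝ) := fun p => p.2 - I (R (E p))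
  have hΦ : AnalyticAt ℝ Φ (0, w₀) := analyticAt_snd.sub ((I.analyticAt _).fun_comp hRE)
  have hc : ContDiffAt ℝ ω Φ (0, w₀) := hΦ.contDiffAt
  have hinv : (fderiv ℝ Φ (0, w₀) ∘L .inr ℝ ℝ (ℝ →ᵇ ℝ)) = .id ℝ _ := by
    have h1 : HasFDerivAt (fun w => Φ (0, w)) (fderiv ℝ Φ (0, w₀) ∘L .inr ℝ ℝ (ℝ →ᵇ ℝ)) w₀ :=
      hΦ.differentiableAt.hasFDerivAt.comp w₀ (hasFDerivAt_prodMk_right 0 w₀)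
    have h2 : HasFDerivAt (fun w => Φ (0, w)) (.id ℝ (ℝ →ᵇ ℝ)) w₀ := by
      simpa [Φ, E] using (hasFDerivAt_id w₀).sub_const (I (R 0))
    exact h1.unique h2
  have if₂ : (fderiv ℝ Φ (0, w₀) ∘L .inr ℝ ℝ (ℝ →ᵇ ℝ)).IsInvertible := by
    rw [hinv]; exact ⟨.refl ℝ _, rfl⟩
  refine ⟨hc.implicitFunction (by simp) if₂,
    (hc.contDiffAt_implicitFunction (by simp) if₂).analyticAt, ?_⟩
  filter_upwards [hc.eventually_apply_implicitFunction (by simp) if₂] with z hz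
  have h0 : Φ (0, w₀) = 0 := by simp [Φ, E, hw₀]
  rw [h0] at hz
  exact sub_eq_zero.1 hz

/-- The restoring force (minus the derivative of `v`) divided by `ρ ^ (2 * n - 1)`, in the weighted polar coordinates
`x = ρ cos θ`, `v = -ρ ^ n sin θ`, for the field with `x' = v h`,
`v' = -x ^ (2 * n - 1) U - x ^ (n - 1) W v + v ^ 2 K`. -/
noncomputable def polarB (n : ℕ) (U W : ℝ → ℝ) (K : ℝ × ℝ → ℝ) (θ ρ : ℝ) : ℝ :=
  Real.cos θ ^ (2 * n - 1) * U (ρ * Real.cos θ)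
    - Real.cos θ ^ (n - 1) * Real.sin θ * W (ρ * Real.cos θ)
    - ρ * Real.sin θ ^ 2 * K (ρ * Real.cos θ, -(ρ ^ n * Real.sin θ))

/-- The angular speed, up to a positive factor, in weighted polar coordinates. -/
noncomputable def polarQ (n : ℕ) (U W : ℝ → ℝ) (h K : ℝ × ℝ → ℝ) (θ ρ : ℝ) : ℝ :=
  n * Real.sin θ ^ 2 * h (ρ * Real.cos θ, -(ρ ^ n * Real.sin θ))
    + Real.cos θ * polarB n U W K θ ρ

/-- The logarithmic radial derivative `ρ' / ρ` with respect to the angle in weighted polar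
coordinates. -/
noncomputable def polarR (n : ℕ) (U W : ℝ → ℝ) (h K : ℝ × ℝ → ℝ) (θ ρ : ℝ) : ℝ :=
  Real.sin θ * (polarB n U W K θ ρ - Real.cos θ * h (ρ * Real.cos θ, -(ρ ^ n * Real.sin θ)))
    / polarQ n U W h K θ ρ

theorem polarQ_zero_lower_bound {n : ℕ} (hn : 2 ≤ n) {U W : ℝ → ℝ} {h : ℝ × ℝ → ℝ}
    (K : ℝ × ℝ → ℝ)
    (h1 : h 0 = 1) (hdisc : W 0 ^ 2 - 4 * n * U 0 < 0) :
    ∃ q > 0, ∀ θ, q ≤ polarQ n U W h K θ 0 := by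
  have hn0 : (0:ℝ) < n := by positivity
  have key : ∀ θ, polarQ n U W h K θ 0 =
      n * Real.sin θ ^ 2 + U 0 * (Real.cos θ ^ n) ^ 2 - W 0 * Real.cos θ ^ n * Real.sin θ := by
    intro θ
    obtain ⟨m, rfl⟩ : ∃ m, n = m + 1 := ⟨n - 1, by omega⟩
    have e1 : 2 * (m + 1) - 1 = 2 * m + 1 := by omega
    have e2 : m + 1 - 1 = m := by omega
    have h1' : h (0, 0) = 1 := h1
    simp only [polarQ, polarB, e1, e2, zero_mul, ne_eq, Nat.succ_ne_zero, not_false_eq_true,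
      zero_pow, neg_zero, h1']
    ring
  have hpos : ∀ θ, 0 < polarQ n U W h K θ 0 := by
    intro θ
    rw [key]
    by_cases hc : Real.cos θ = 0
    · have hs : Real.sin θ ^ 2 = 1 := by
        have := Real.sin_sq_add_cos_sq θ; rw [hc] at this; linarith
      have hn1 : n ≠ 0 := by omega
      rw [hc, zero_pow hn1, hs]
      simpa using hn0
    · have hC : 0 < (Real.cos θ ^ n) ^ 2 := by positivity
      nlinarith [sq_nonneg (2 * n * Real.sin θ - W 0 * Real.cos θ ^ n),
        mul_pos hC (neg_pos.2 hdisc)]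
  have hcont : Continuous fun θ => polarQ n U W h K θ 0 := by
    simp_rw [key]; fun_prop
  have hper : Function.Periodic (fun θ => polarQ n U W h K θ 0) (2 * Real.pi) := by
    intro θ
    simp [key]
  obtain ⟨q, ⟨⟨θ₀, hθ₀⟩, hq⟩⟩ := (hper.compact_of_continuous (by positivity) hcont).exists_isLeast
    (range_nonempty _)
  exact ⟨q, hθ₀ ▸ hpos θ₀, fun θ => hq ⟨θ, rfl⟩⟩

/-- The cosine as a bounded continuous function. -/
noncomputable def cosB : ℝ →ᵇ ℝ :=
  .ofNormedAddCommGroup Real.cos Real.continuous_cos 1 Real.abs_cos_le_one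

/-- The sine as a bounded continuous function. -/
noncomputable def sinB : ℝ →ᵇ ℝ :=
  .ofNormedAddCommGroup Real.sin Real.continuous_sin 1 Real.abs_sin_le_one

@[simp] theorem cosB_apply (θ : ℝ) : cosB θ = Real.cos θ := rfl

@[simp] theorem sinB_apply (θ : ℝ) : sinB θ = Real.sin θ := rfl

theorem isUnit_of_lower_bound {u : ℝ →ᵇ ℝ} {q : ℝ} (hq : 0 < q) (hu : ∀ s, q ≤ u s) :
    IsUnit u := by
  have hpos : ∀ s, 0 < u s := fun s => hq.trans_le (hu s)
  refine IsUnit.of_mul_eq_one (BoundedContinuousFunction.ofNormedAddCommGroup (fun s => (u s)⁻¹)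
    (u.continuous.inv₀ fun s => (hpos s).ne') q⁻¹ fun s => ?_) ?_
  · rw [norm_inv, Real.norm_of_nonneg (hpos s).le]
    gcongr
    exact hu s
  · ext s
    exact mul_inv_cancel₀ (hpos s).ne'

theorem exists_polar_field {n : ℕ} (hn : 2 ≤ n) {U W : ℝ → ℝ} {h K : ℝ × ℝ → ℝ}
    (hUa : AnalyticAt ℝ U 0) (hWa : AnalyticAt ℝ W 0) (hha : AnalyticAt ℝ h 0)
    (hKa : AnalyticAt ℝ K 0) (h1 : h 0 = 1) (hdisc : W 0 ^ 2 - 4 * n * U 0 < 0) :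
    ∃ R : (ℝ →ᵇ ℝ) → (ℝ →ᵇ ℝ), AnalyticAt ℝ R 0 ∧ ∀ᶠ r in 𝓝 (0 : ℝ →ᵇ ℝ),
      Continuous (fun θ => polarQ n U W h K θ (r θ)) ∧
      ∀ θ, 0 < polarQ n U W h K θ (r θ) ∧ R r θ = polarR n U W h K θ (r θ) := by
  have hn0 : n ≠ 0 := by omega
  obtain ⟨NU, hNU, eU⟩ := exists_superposition hUa
  obtain ⟨NW, hNW, eW⟩ := exists_superposition hWa
  obtain ⟨Nh, hNh, eh⟩ := exists_superposition₂ hha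
  obtain ⟨NK, hNK, eK⟩ := exists_superposition₂ hKa
  have hx : AnalyticAt ℝ (fun r : ℝ →ᵇ ℝ => r * cosB) 0 := by fun_prop
  have hp : AnalyticAt ℝ (fun r : ℝ →ᵇ ℝ => (r * cosB, -(r ^ n * sinB))) 0 := by fun_prop
  have tx : Tendsto (fun r : ℝ →ᵇ ℝ => r * cosB) (𝓝 0) (𝓝 0) := by
    simpa using hx.continuousAt.tendsto
  have tp : Tendsto (fun r : ℝ →ᵇ ℝ => (r * cosB, -(r ^ n * sinB))) (𝓝 0) (𝓝 0) := by
    simpa [hn0, ← Prod.zero_eq_mk] using hp.continuousAt.tendsto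
  have aU : AnalyticAt ℝ (fun r => NU (r * cosB)) 0 := AnalyticAt.fun_comp (by simpa) hx
  have aW : AnalyticAt ℝ (fun r => NW (r * cosB)) 0 := AnalyticAt.fun_comp (by simpa) hx
  have ah : AnalyticAt ℝ (fun r => Nh (r * cosB, -(r ^ n * sinB))) 0 :=
    AnalyticAt.fun_comp (by simpa [hn0, ← Prod.zero_eq_mk] using hNh) hp
  have aK : AnalyticAt ℝ (fun r => NK (r * cosB, -(r ^ n * sinB))) 0 :=
    AnalyticAt.fun_comp (by simpa [hn0, ← Prod.zero_eq_mk] using hNK) hp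
  let B : (ℝ →ᵇ ℝ) → (ℝ →ᵇ ℝ) := fun r => cosB ^ (2 * n - 1) * NU (r * cosB)
    - cosB ^ (n - 1) * sinB * NW (r * cosB) - r * sinB ^ 2 * NK (r * cosB, -(r ^ n * sinB))
  have aB : AnalyticAt ℝ B 0 := ((analyticAt_const.mul aU).sub (analyticAt_const.mul aW)).sub
    ((analyticAt_id.mul analyticAt_const).mul aK)
  let Q : (ℝ →ᵇ ℝ) → (ℝ →ᵇ ℝ) := fun r =>
    (n : ℝ) • (sinB ^ 2 * Nh (r * cosB, -(r ^ n * sinB))) + cosB * B r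
  have aQ : AnalyticAt ℝ Q 0 :=
    ((analyticAt_const (v := (n : ℝ))).smul ((analyticAt_const (v := sinB ^ 2)).mul ah)).add
      ((analyticAt_const (v := cosB)).mul aB)
  have ev : ∀ᶠ r in 𝓝 (0 : ℝ →ᵇ ℝ), ∀ θ, B r θ = polarB n U W K θ (r θ) ∧
      Q r θ = polarQ n U W h K θ (r θ) ∧
      Nh (r * cosB, -(r ^ n * sinB)) θ
        = h (r θ * Real.cos θ, -(r θ ^ n * Real.sin θ)) := by
    filter_upwards [tx.eventually eU, tx.eventually eW, tp.eventually eh, tp.eventually eK]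
      with r hrU hrW hrh hrK θ
    have hB : B r θ = polarB n U W K θ (r θ) := by
      simp [B, polarB, hrU, hrW, hrK]
    refine ⟨hB, ?_, ?_⟩
    · simp [Q, polarQ, hB, hrh, mul_assoc]
    · simp [hrh]
  obtain ⟨q, hq, hqle⟩ := polarQ_zero_lower_bound hn K h1 hdisc
  have hQ0 : ∀ θ, q ≤ Q 0 θ := fun θ => by
    rw [(ev.self_of_nhds θ).2.1]; exact hqle θ
  have hlow : ∀ᶠ r in 𝓝 (0 : ℝ →ᵇ ℝ), ∀ θ, q / 2 ≤ Q r θ := by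
    filter_upwards [aQ.continuousAt (Metric.ball_mem_nhds _ (half_pos hq))] with r hr θ
    have h2 := (BoundedContinuousFunction.dist_coe_le_dist (f := Q r) (g := Q 0) θ).trans_lt hr
    rw [Real.dist_eq, abs_lt] at h2
    linarith [hQ0 θ, h2.1]
  obtain ⟨u, hu⟩ := isUnit_of_lower_bound hq hQ0
  have aI : AnalyticAt ℝ (fun r => Ring.inverse (Q r)) 0 :=
    AnalyticAt.fun_comp (by rw [← hu]; exact analyticAt_inverse u) aQ
  refine ⟨fun r => sinB * (B r - cosB * Nh (r * cosB, -(r ^ n * sinB))) * Ring.inverse (Q r),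
    (analyticAt_const.mul (aB.sub (analyticAt_const.mul ah))).mul aI, ?_⟩
  filter_upwards [ev, hlow] with r hr hl
  refine ⟨(Q r).continuous.congr fun θ => (hr θ).2.1, fun θ => ?_⟩
  obtain ⟨hB, hQ, hh⟩ := hr θ
  have hpos : 0 < Q r θ := (half_pos hq).trans_le (hl θ)
  refine ⟨hQ ▸ hpos, ?_⟩
  have hinv : Ring.inverse (Q r) θ = (Q r θ)⁻¹ := by
    have h3 := Ring.mul_inverse_cancel _ (isUnit_of_lower_bound (half_pos hq) hl)
    have h4 := DFunLike.congr_fun h3 θ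
    exact (inv_eq_of_mul_eq_one_right h4).symm
  simp only [BoundedContinuousFunction.mul_apply, BoundedContinuousFunction.sub_apply, hinv, hB,
    hh, hQ, cosB_apply, sinB_apply, polarR, div_eq_mul_inv]

theorem exists_polar_solution {n : ℕ} (hn : 2 ≤ n) {U W : ℝ → ℝ} {h K : ℝ × ℝ → ℝ}
    (hUa : AnalyticAt ℝ U 0) (hWa : AnalyticAt ℝ W 0) (hha : AnalyticAt ℝ h 0)
    (hKa : AnalyticAt ℝ K 0) (h1 : h 0 = 1) (hdisc : W 0 ^ 2 - 4 * n * U 0 < 0)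
    {a b : ℝ} (hab : (0:ℝ) ∈ Ioo a b) :
    ∃ Λ : ℝ → (ℝ →ᵇ ℝ), AnalyticAt ℝ Λ 0 ∧
      (∀ p : ℝ × ℝ → Prop, (∀ᶠ q in 𝓝 0, p q) → ∀ᶠ z in 𝓝 (0 : ℝ), ∀ θ,
        p (z * Real.exp (Λ z θ) * Real.cos θ, -((z * Real.exp (Λ z θ)) ^ n * Real.sin θ))) ∧
      ∀ᶠ z in 𝓝 (0 : ℝ), Λ z 0 = 0 ∧
      Continuous (fun θ => polarQ n U W h K θ (z * Real.exp (Λ z θ))) ∧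
      ∀ θ, 0 < polarQ n U W h K θ (z * Real.exp (Λ z θ)) ∧
        (θ ∈ Ioo a b → HasDerivAt (Λ z) (polarR n U W h K θ (z * Real.exp (Λ z θ))) θ) := by
  obtain ⟨R, hR, hev⟩ := exists_polar_field hn hUa hWa hha hKa h1 hdisc
  obtain ⟨Λ, hΛ, hfix⟩ := exists_analytic_fixed (primL a b) hR
  have tz : Tendsto (fun z : ℝ => z • NormedSpace.exp (Λ z)) (𝓝 0) (𝓝 0) := by
    have : ContinuousAt (fun z : ℝ => z • NormedSpace.exp (Λ z)) 0 :=
      continuousAt_id.smul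
        ((NormedSpace.exp_continuous (𝔸 := ℝ →ᵇ ℝ)).continuousAt.comp hΛ.continuousAt)
    simpa [ContinuousAt] using this
  have hval : ∀ z θ, (z • NormedSpace.exp (Λ z)) θ = z * Real.exp (Λ z θ) := by
    intro z θ; simp [exp_apply_bcf]
  have hn0 : n ≠ 0 := by omega
  refine ⟨Λ, hΛ, fun p hp => ?_, ?_⟩
  · have hc : Continuous fun r : ℝ →ᵇ ℝ => pairL (r * cosB, -(r ^ n * sinB)) := by fun_prop
    have tc : Tendsto (fun z : ℝ => pairL (z • NormedSpace.exp (Λ z) * cosB,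
        -((z • NormedSpace.exp (Λ z)) ^ n * sinB))) (𝓝 0) (𝓝 0) :=
      (hc.tendsto' 0 0 (by simp [hn0, ← Prod.zero_eq_mk])).comp tz
    obtain ⟨ε, hε, hball⟩ := Metric.eventually_nhds_iff_ball.1 hp
    filter_upwards [tc (Metric.ball_mem_nhds _ hε)] with z hz θ
    have h2 := (BoundedContinuousFunction.norm_coe_le_norm _ θ).trans_lt (mem_ball_zero_iff.1 hz)
    rw [pairL_apply] at h2
    have h3 := hball _ (mem_ball_zero_iff.2 h2)
    simpa [hval, exp_apply_bcf] using h3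
  filter_upwards [hfix, tz.eventually hev] with z hz ⟨hzc, hzev⟩
  simp only [hval] at hzc hzev
  refine ⟨?_, hzc, fun θ => ⟨(hzev θ).1, fun hθ => ?_⟩⟩
  · rw [hz, primL_apply (Ioo_subset_Icc_self hab)]
    simp
  · rw [← (hzev θ).2]
    have hd := ((R (z • NormedSpace.exp (Λ z))).continuous.integral_hasStrictDerivAt 0 θ).hasDerivAt
    refine hd.congr_of_eventuallyEq ?_
    filter_upwards [isOpen_Ioo.mem_nhds hθ] with s hs
    conv_lhs => rw [hz]
    rw [primL_apply (Ioo_subset_Icc_self hs)]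

theorem hasDerivAt_of_eventually_eq_mul {G H : ℝ × ℝ → ℝ} (hH : AnalyticAt ℝ H 0)
    (hG : ∀ᶠ p in 𝓝 (0 : ℝ × ℝ), G p = p.2 * H p) :
    ∀ᶠ x in 𝓝 (0 : ℝ), HasDerivAt (fun v => G (x, v)) (H (x, 0)) 0 := by
  have ht : Tendsto (fun x : ℝ => (x, (0 : ℝ))) (𝓝 0) (𝓝 0) :=
    Continuous.tendsto' (by fun_prop) _ _ rfl
  filter_upwards [ht.eventually hG.eventually_nhds, ht.eventually hH.eventually_analyticAt]
    with x hx hxH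
  have hc : Tendsto (fun v : ℝ => (x, v)) (𝓝 0) (𝓝 (x, 0)) :=
    Continuous.tendsto' (by fun_prop) _ _ rfl
  have h1 : HasDerivAt (fun v : ℝ => H (x, v)) (fderiv ℝ H (x, 0) (0, 1)) 0 :=
    hxH.differentiableAt.hasFDerivAt.comp_hasDerivAt (0 : ℝ)
      ((hasDerivAt_const (0 : ℝ) x).prodMk (hasDerivAt_id (0 : ℝ)))
  have h2 := (hasDerivAt_id (0 : ℝ)).mul h1
  simp only [id, one_mul, zero_mul, add_zero] at h2
  exact h2.congr_of_eventuallyEq (hc.eventually hx)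

/-- In the coordinates `(x, v) = (x, y - F x)` the system reads `x' = v h`,
`v' = -x ^ (2 * n - 1) U - x ^ (n - 1) W v + v ^ 2 K`. -/
theorem exists_normal_form {n : ℕ} {X Y : ℝ × ℝ → ℝ} {F U W : ℝ → ℝ}
    (hX : AnalyticAt ℝ X 0) (hY : AnalyticAt ℝ Y 0) (hF : AnalyticAt ℝ F 0)
    (hU : AnalyticAt ℝ U 0) (hW : AnalyticAt ℝ W 0) (hF0 : F 0 = 0)
    (hXsmall : X =O[𝓝 0] fun p => ‖p‖ ^ 2) (hFsol : ∀ᶠ x in 𝓝 (0 : ℝ), F x + X (x, F x) = 0)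
    (hg : ∀ᶠ x in 𝓝 (0 : ℝ), -Y (x, F x) = x ^ (2 * n - 1) * U x)
    (hf : ∀ᶠ x in 𝓝 (0 : ℝ), -(deriv (fun s => X (s, F x)) x + deriv (fun s => Y (x, s)) (F x))
      = x ^ (n - 1) * W x) :
    ∃ h K : ℝ × ℝ → ℝ, AnalyticAt ℝ h 0 ∧ AnalyticAt ℝ K 0 ∧ h 0 = 1 ∧
      ∀ᶠ p in 𝓝 (0 : ℝ × ℝ), F p.1 + p.2 + X (p.1, F p.1 + p.2) = p.2 * h p ∧
        Y (p.1, F p.1 + p.2) = deriv F p.1 * (p.2 * h p)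
          + (-(p.1 ^ (2 * n - 1) * U p.1) - p.1 ^ (n - 1) * W p.1 * p.2 + p.2 ^ 2 * K p) := by
  have fst_an {f : ℝ → ℝ} (hf : AnalyticAt ℝ f 0) :
      AnalyticAt ℝ (fun p : ℝ × ℝ => f p.1) 0 := AnalyticAt.fun_comp hf analyticAt_fst
  have hσ : AnalyticAt ℝ (fun p : ℝ × ℝ => (p.1, F p.1 + p.2)) 0 :=
    analyticAt_fst.prod ((fst_an hF).add analyticAt_snd)
  have hσ0 : ((0 : ℝ × ℝ).1, F (0 : ℝ × ℝ).1 + (0 : ℝ × ℝ).2) = 0 := by simp [hF0]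
  have hXσ : AnalyticAt ℝ (fun p : ℝ × ℝ => X (p.1, F p.1 + p.2)) 0 :=
    AnalyticAt.fun_comp (by rwa [hσ0]) hσ
  have hYσ : AnalyticAt ℝ (fun p : ℝ × ℝ => Y (p.1, F p.1 + p.2)) 0 :=
    AnalyticAt.fun_comp (by rwa [hσ0]) hσ
  have hσx : Tendsto (fun x : ℝ => (x, F x)) (𝓝 0) (𝓝 0) := by
    have : ContinuousAt (fun x : ℝ => (x, F x)) 0 := continuousAt_id.prodMk hF.continuousAt
    simpa [ContinuousAt, hF0] using! this
  obtain ⟨h, hh, eh⟩ := exists_eq_snd_mul_of_analyticAt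
    (G := fun p => F p.1 + p.2 + X (p.1, F p.1 + p.2))
    (((fst_an hF).add analyticAt_snd).add hXσ) (by simpa using hFsol)
  have dh := hasDerivAt_of_eventually_eq_mul hh eh
  have dm := hasDerivAt_of_eventually_eq_mul (G := fun p => p.2 * h p) hh (Eventually.of_forall
    fun _ => rfl)
  have vert {Z : ℝ × ℝ → ℝ} {x : ℝ} (hZ : AnalyticAt ℝ Z (x, F x)) :
      HasDerivAt (fun v => Z (x, F x + v)) (fderiv ℝ Z (x, F x) (0, 1)) 0 := by
    have h2 : HasDerivAt (fun v : ℝ => (x, F x + v)) (0, 1) 0 :=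
      (hasDerivAt_const (0 : ℝ) x).prodMk ((hasDerivAt_id (0 : ℝ)).const_add (F x))
    exact HasFDerivAt.comp_hasDerivAt (0 : ℝ) (by simpa using hZ.differentiableAt.hasFDerivAt) h2
  have hx0 : ∀ᶠ x in 𝓝 (0 : ℝ), h (x, 0) = 1 + fderiv ℝ X (x, F x) (0, 1) := by
    filter_upwards [dh, hσx.eventually hX.eventually_analyticAt] with x hx hxX
    exact hx.unique (((hasDerivAt_id (0 : ℝ)).const_add (F x)).add (vert hxX))
  have h0 : h 0 = 1 := by
    have hX0 : fderiv ℝ X 0 = 0 :=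
      (Asymptotics.IsBigO.hasFDerivAt (x₀ := 0) (by simpa using hXsmall) one_lt_two).fderiv
    have := hx0.self_of_nhds
    simpa [hF0, ← Prod.zero_eq_mk, hX0] using this
  obtain ⟨H, hH, eH⟩ := exists_eq_snd_mul_of_analyticAt
    (G := fun p => Y (p.1, F p.1 + p.2) - deriv F p.1 * (p.2 * h p) + p.1 ^ (2 * n - 1) * U p.1)
    ((hYσ.sub ((fst_an hF.deriv).mul (analyticAt_snd.mul hh))).add
      ((analyticAt_fst.pow _).mul (fst_an hU))) (by
        filter_upwards [hg] with x hx
        simp [← hx])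
  have dH := hasDerivAt_of_eventually_eq_mul hH eH
  obtain ⟨K, hK, eK⟩ := exists_eq_snd_mul_of_analyticAt (G := fun p => H p + p.1 ^ (n - 1) * W p.1)
    (hH.add ((analyticAt_fst.pow _).mul (fst_an hW))) (by
      filter_upwards [dH, dm, hx0, hf, hσx.eventually hX.eventually_analyticAt,
        hσx.eventually hY.eventually_analyticAt, hFsol.eventually_nhds, hF.eventually_analyticAt]
        with x hxH hxm hxh0 hxf hxX hxY hxF hxFa
      have e2 : H (x, 0) = fderiv ℝ Y (x, F x) (0, 1) - deriv F x * h (x, 0) :=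
        hxH.unique (((vert hxY).sub (hxm.const_mul (deriv F x))).add_const _)
      have e3 : deriv (fun s => X (s, F x)) x = fderiv ℝ X (x, F x) (1, 0) :=
        (hxX.differentiableAt.hasFDerivAt.comp_hasDerivAt x
          ((hasDerivAt_id x).prodMk (hasDerivAt_const x (F x)))).deriv
      have e4 : deriv (fun s => Y (x, s)) (F x) = fderiv ℝ Y (x, F x) (0, 1) :=
        (hxY.differentiableAt.hasFDerivAt.comp_hasDerivAt (F x)
          ((hasDerivAt_const (F x) x).prodMk (hasDerivAt_id (F x)))).deriv
      have e5 : HasDerivAt (fun s => F s + X (s, F s))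
          (deriv F x + fderiv ℝ X (x, F x) (1, deriv F x)) x :=
        hxFa.differentiableAt.hasDerivAt.add (hxX.differentiableAt.hasFDerivAt.comp_hasDerivAt x
          ((hasDerivAt_id x).prodMk hxFa.differentiableAt.hasDerivAt))
      have e6 : deriv F x + fderiv ℝ X (x, F x) (1, deriv F x) = 0 :=
        e5.unique ((hasDerivAt_const x (0 : ℝ)).congr_of_eventuallyEq hxF)
      have e7 : fderiv ℝ X (x, F x) (1, deriv F x)
          = fderiv ℝ X (x, F x) (1, 0) + deriv F x * fderiv ℝ X (x, F x) (0, 1) := by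
        rw [← smul_eq_mul, ← map_smul, ← map_add]
        simp
      rw [e3, e4] at hxf
      simp only [e2, hxh0]
      linear_combination (-1 : ℝ) * hxf - e6 + e7)
  refine ⟨h, K, hh, hK, h0, ?_⟩
  filter_upwards [eh, eH, eK] with p h1 h2 h3
  exact ⟨h1, by linear_combination h2 + p.2 * h3⟩

theorem polar_radial_identity {n c s ρ ρm h B Q : ℝ} (hρm : ρm ≠ 0) (hQ : Q ≠ 0)
    (hQdef : Q = n * s ^ 2 * h + c * B) :
    ρ * (s * (B - c * h) / Q) * c - ρ * s
      = (c ^ 2 + n * s ^ 2) / (ρm * Q) * (-(ρm * ρ * s) * h) := by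
  field_simp
  rw [hQdef]
  ring

theorem polar_angular_identity {n c s ρ ρm h B Q : ℝ} (hρm : ρm ≠ 0) (hQ : Q ≠ 0)
    (hQdef : Q = n * s ^ 2 * h + c * B) :
    -(n * ρm * (ρ * (s * (B - c * h) / Q)) * s + ρm * ρ * c)
      = (c ^ 2 + n * s ^ 2) / (ρm * Q) * (-(ρm ^ 2 * ρ * B)) := by
  field_simp
  rw [hQdef]
  ring

/-- A reparametrised integral curve coincides with the integral curve. -/
theorem exists_time_change {V : ℝ × ℝ → ℝ × ℝ} {ε L : ℝ} {k : NNReal}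
    (hV : LipschitzOnWith k V (Metric.ball 0 ε)) {γ c : ℝ → ℝ × ℝ} {κ : ℝ → ℝ}
    (hκ : Continuous κ) (hκ0 : ∀ θ, 0 < κ θ) (hγ : ∀ t, HasDerivAt γ (V (γ t)) t)
    (hc : ∀ θ ∈ Icc 0 L, c θ ∈ Metric.ball 0 ε ∧ HasDerivAt c (κ θ • V (c θ)) θ)
    (h0 : γ 0 = c 0) :
    ∃ T : ℝ → ℝ, Continuous T ∧ StrictMono T ∧ T 0 = 0 ∧ ∀ θ ∈ Icc 0 L, γ (T θ) = c θ := by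
  let T : ℝ → ℝ := fun θ => ∫ s in (0 : ℝ)..θ, κ s
  have hT : ∀ θ, HasDerivAt T (κ θ) θ := fun θ => (hκ.integral_hasStrictDerivAt 0 θ).hasDerivAt
  have hTc : Continuous T := continuous_iff_continuousAt.2 fun θ => (hT θ).continuousAt
  have hγc : Continuous γ := continuous_iff_continuousAt.2 fun t => (hγ t).continuousAt
  have hT0 : T 0 = 0 := intervalIntegral.integral_same
  have hcc : ContinuousOn c (Icc 0 L) := fun θ hθ => (hc θ hθ).2.continuousAt.continuousWithinAt
  have hγT : ∀ θ, HasDerivAt (fun θ => γ (T θ)) (κ θ • V (γ (T θ))) θ :=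
    fun θ => (hγ (T θ)).scomp θ (hT θ)
  obtain ⟨M, hM⟩ := isCompact_Icc.exists_bound_of_continuousOn (hκ.continuousOn (s := Icc 0 L))
  refine ⟨T, hTc, strictMono_of_hasDerivAt_pos hT hκ0, hT0, ?_⟩
  have hclosed : IsClosed ({θ | γ (T θ) = c θ} ∩ Icc 0 L) := by
    have : {θ | γ (T θ) = c θ} ∩ Icc 0 L = {θ ∈ Icc 0 L | γ (T θ) = c θ} := by
      ext θ; simp [and_comm]
    rw [this]
    exact isClosed_Icc.isClosed_eq (hγc.comp hTc).continuousOn hcc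
  refine hclosed.Icc_subset_of_forall_exists_gt (by simp [hT0, h0]) ?_
  rintro θ ⟨hθ, hθL⟩ y (hy : θ < y)
  have hmem : γ (T θ) ∈ Metric.ball (0 : ℝ × ℝ) ε := by
    rw [show γ (T θ) = c θ from hθ]; exact (hc θ (Ico_subset_Icc_self hθL)).1
  have hnear : ∀ᶠ s in 𝓝 θ, γ (T s) ∈ Metric.ball (0 : ℝ × ℝ) ε :=
    (hγc.comp hTc).continuousAt (Metric.isOpen_ball.mem_nhds hmem)
  obtain ⟨δ, hδ, hδball⟩ := Metric.eventually_nhds_iff.1 hnear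
  let b := min (min y L) (θ + δ / 2)
  have hb : θ < b := lt_min (lt_min hy hθL.2) (by linarith)
  have hbL : b ≤ L := (min_le_left _ _).trans (min_le_right _ _)
  have hby : b ≤ y := (min_le_left _ _).trans (min_le_left _ _)
  have hbδ : b ≤ θ + δ / 2 := min_le_right _ _
  have hsub : ∀ t ∈ Ico θ b, t ∈ Icc 0 L := fun t ht =>
    ⟨hθL.1.trans ht.1, ht.2.le.trans hbL⟩
  have hlip : ∀ t ∈ Ico θ b, LipschitzOnWith (M.toNNReal * k) (fun p => κ t • V p)
      (Metric.ball 0 ε) := by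
    intro t ht
    refine LipschitzOnWith.of_dist_le_mul fun p hp q hq => ?_
    rw [dist_smul₀, NNReal.coe_mul, mul_assoc]
    gcongr
    · exact (hM t (hsub t ht)).trans (Real.le_coe_toNNReal M)
    · exact hV.dist_le_mul p hp q hq
  have hEq := ODE_solution_unique_of_mem_Icc_right hlip
    (hγc.comp hTc).continuousOn (fun t _ => (hγT t).hasDerivWithinAt)
    (fun t ht => hδball (by
      rw [Real.dist_eq, abs_lt]; constructor <;> linarith [ht.1, ht.2]))
    (hcc.mono (Icc_subset_Icc hθL.1 hbL)) (fun t ht => (hc t (hsub t ht)).2.hasDerivWithinAt)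
    (fun t ht => (hc t (hsub t ht)).1) hθ
  exact ⟨b, hEq (right_mem_Icc.2 hb.le), hb, hby⟩

/-- Orbits of the system near the origin, parametrised by the weighted polar angle over one turn. -/
theorem exists_polar_orbit {n : ℕ} (hn : 2 ≤ n) (hodd : Odd n) {X Y : ℝ × ℝ → ℝ} {F U W : ℝ → ℝ}
    (hX : AnalyticAt ℝ X 0) (hY : AnalyticAt ℝ Y 0) (hF : AnalyticAt ℝ F 0)
    (hU : AnalyticAt ℝ U 0) (hW : AnalyticAt ℝ W 0) (hF0 : F 0 = 0)
    (hXsmall : X =O[𝓝 0] fun p => ‖p‖ ^ 2) (hFsol : ∀ᶠ x in 𝓝 (0 : ℝ), F x + X (x, F x) = 0)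
    (hg : ∀ᶠ x in 𝓝 (0 : ℝ), -Y (x, F x) = x ^ (2 * n - 1) * U x)
    (hf : ∀ᶠ x in 𝓝 (0 : ℝ), -(deriv (fun s => X (s, F x)) x + deriv (fun s => Y (x, s)) (F x))
      = x ^ (n - 1) * W x)
    (hdisc : W 0 ^ 2 - 4 * n * U 0 < 0) :
    ∃ Pb : ℝ → ℝ, AnalyticAt ℝ Pb 0 ∧ Pb 0 = 0 ∧ 0 < deriv Pb 0 ∧ ∀ ε > 0, ∀ᶠ z in 𝓝 (0 : ℝ),
      z ≠ 0 → ∃ (c : ℝ → ℝ × ℝ) (κ : ℝ → ℝ), Continuous κ ∧ (∀ θ, 0 < κ θ) ∧ c 0 = (z, F z) ∧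
        c (2 * Real.pi) = (Pb z, F (Pb z)) ∧ 0 < z * Pb z ∧
        (∀ θ ∈ Ioo 0 (2 * Real.pi), ¬((c θ).2 = F (c θ).1 ∧ 0 < z * (c θ).1)) ∧
        ∀ θ ∈ Icc 0 (2 * Real.pi), c θ ∈ Metric.ball 0 ε ∧
          HasDerivAt c (κ θ • ((c θ).2 + X (c θ), Y (c θ))) θ := by
  obtain ⟨h, K, hh, hK, h1, hnf⟩ := exists_normal_form hX hY hF hU hW hF0 hXsmall hFsol hg hf
  have hpi := Real.pi_pos
  obtain ⟨Λ, hΛ, hsmall, hΛev⟩ := exists_polar_solution hn hU hW hh hK h1 hdisc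
    (a := -1) (b := 2 * Real.pi + 1) ⟨by norm_num, by positivity⟩
  have hA : AnalyticAt ℝ (fun z => Real.exp (Λ z (2 * Real.pi))) 0 :=
    AnalyticAt.rexp
      (((BoundedContinuousFunction.evalCLM ℝ (2 * Real.pi)).analyticAt _).fun_comp hΛ)
  refine ⟨fun z => z * Real.exp (Λ z (2 * Real.pi)), analyticAt_id.mul hA, by simp, ?_, ?_⟩
  · have hd := (hasDerivAt_id (0 : ℝ)).mul hA.differentiableAt.hasDerivAt
    simp only [id, one_mul, zero_mul, add_zero] at hd
    rw [show deriv (fun z => z * Real.exp (Λ z (2 * Real.pi))) 0 = _ from hd.deriv]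
    exact Real.exp_pos _
  intro ε hε
  have hσ : ContinuousAt (fun p : ℝ × ℝ => (p.1, F p.1 + p.2)) 0 :=
    continuousAt_fst.prodMk ((ContinuousAt.comp (f := Prod.fst) (x := (0 : ℝ × ℝ))
      hF.continuousAt continuousAt_fst).add continuousAt_snd)
  have hσε : ∀ᶠ p in 𝓝 (0 : ℝ × ℝ), (p.1, F p.1 + p.2) ∈ Metric.ball (0 : ℝ × ℝ) ε :=
    hσ.eventually (Metric.isOpen_ball.mem_nhds (by simpa [hF0] using hε))
  have hFd : ∀ᶠ p in 𝓝 (0 : ℝ × ℝ), DifferentiableAt ℝ F p.1 :=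
    (continuous_fst.tendsto' (0 : ℝ × ℝ) 0 rfl).eventually
      (hF.eventually_analyticAt.mono fun x hx => hx.differentiableAt)
  filter_upwards [hΛev, hsmall _ (hnf.and (hσε.and hFd))] with z ⟨hz0, hQc, hzθ⟩ hzp hz
  set ρ : ℝ → ℝ := fun θ => z * Real.exp (Λ z θ) with hρ
  have hρ0 : ∀ θ, ρ θ ≠ 0 := fun θ => mul_ne_zero hz (Real.exp_pos _).ne'
  have hzρ : ∀ θ, 0 < z * ρ θ := fun θ => by
    rw [hρ, ← mul_assoc]
    exact mul_pos (mul_self_pos.2 hz) (Real.exp_pos _)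
  have hρc : Continuous ρ := by fun_prop
  obtain ⟨m, rfl⟩ : ∃ m, n = m + 1 := ⟨n - 1, by omega⟩
  have hm : Even m := by
    rcases Nat.even_or_odd m with hm | hm
    · exact hm
    · exact absurd hodd (Nat.not_odd_iff_even.2 hm.add_one)
  have hρm : ∀ θ, 0 < ρ θ ^ m := fun θ => hm.pow_pos (hρ0 θ)
  let Q : ℝ → ℝ := fun θ => polarQ (m + 1) U W h K θ (ρ θ)
  have hQpos : ∀ θ, 0 < Q θ := fun θ => (hzθ θ).1
  let x : ℝ → ℝ := fun θ => ρ θ * Real.cos θ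
  let v : ℝ → ℝ := fun θ => -(ρ θ ^ (m + 1) * Real.sin θ)
  let κ : ℝ → ℝ := fun θ =>
    (Real.cos θ ^ 2 + ((m + 1 : ℕ) : ℝ) * Real.sin θ ^ 2) / (ρ θ ^ m * Q θ)
  have hκ0 : ∀ θ, 0 < κ θ := by
    intro θ
    refine div_pos ?_ (mul_pos (hρm θ) (hQpos θ))
    have := Real.sin_sq_add_cos_sq θ
    push_cast
    nlinarith [sq_nonneg (Real.sin θ), mul_nonneg (Nat.cast_nonneg (α := ℝ) m)
      (sq_nonneg (Real.sin θ))]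
  have hκ : Continuous κ := by
    refine Continuous.div (by fun_prop) ((hρc.pow m).mul hQc) fun θ => ?_
    exact (mul_pos (hρm θ) (hQpos θ)).ne'
  have hρ00 : ρ 0 = z := by simp [hρ, hz0]
  refine ⟨fun θ => (x θ, F (x θ) + v θ), κ, hκ, hκ0, ?_, ?_, hzρ _, ?_, ?_⟩
  · simp [x, v, hρ00]
  · simp [x, v, hρ]
  · rintro θ ⟨hθ0, hθ1⟩ ⟨h2, h3⟩
    have hv : v θ = 0 := by simpa using h2
    have hs : Real.sin θ = 0 := by
      have := neg_eq_zero.1 hv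
      exact (mul_eq_zero.1 this).resolve_left (pow_ne_zero _ (hρ0 θ))
    have hθ : θ = Real.pi := by
      have h4 : Real.sin (θ - Real.pi) = 0 := by rw [Real.sin_sub_pi, hs, neg_zero]
      have := (Real.sin_eq_zero_iff_of_lt_of_lt (by linarith) (by linarith)).1 h4
      linarith
    have h5 : 0 < z * (ρ θ * Real.cos θ) := h3
    rw [hθ, Real.cos_pi] at h5
    linarith [hzρ Real.pi]
  · intro θ hθ
    obtain ⟨⟨n1, n2⟩, hball, hFx⟩ := hzp θ
    refine ⟨hball, ?_⟩
    have hΛ' := (hzθ θ).2 ⟨by linarith [hθ.1], by linarith [hθ.2]⟩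
    have hρ' : HasDerivAt ρ (ρ θ * polarR (m + 1) U W h K θ (ρ θ)) θ := by
      have := (hΛ'.exp).const_mul z
      rwa [← mul_assoc] at this
    have hx' := hρ'.mul (Real.hasDerivAt_cos θ)
    have hv' := ((hρ'.pow (m + 1)).mul (Real.hasDerivAt_sin θ)).neg
    have i1 := polar_radial_identity (n := ((m + 1 : ℕ) : ℝ)) (c := Real.cos θ) (s := Real.sin θ)
      (ρ := ρ θ) (h := h (x θ, v θ)) (B := polarB (m + 1) U W K θ (ρ θ)) (hρm θ).ne'
      (hQpos θ).ne' rfl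
    have i2 := polar_angular_identity (n := ((m + 1 : ℕ) : ℝ)) (c := Real.cos θ) (s := Real.sin θ)
      (ρ := ρ θ) (h := h (x θ, v θ)) (B := polarB (m + 1) U W K θ (ρ θ)) (hρm θ).ne'
      (hQpos θ).ne' rfl
    have dx : HasDerivAt x (κ θ * (v θ * h (x θ, v θ))) θ := by
      refine hx'.congr_deriv ?_
      have : v θ = -(ρ θ ^ m * ρ θ * Real.sin θ) := by simp only [v, pow_succ]
      rw [this]
      refine Eq.trans ?_ i1
      simp only [polarR, Q, x, v]
      ring
    have dv : HasDerivAt v (κ θ * (-(x θ ^ (2 * (m + 1) - 1) * U (x θ))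
        - x θ ^ (m + 1 - 1) * W (x θ) * v θ + v θ ^ 2 * K (x θ, v θ))) θ := by
      refine hv'.congr_deriv ?_
      have e1 : 2 * (m + 1) - 1 = 2 * m + 1 := by omega
      have e2 : m + 1 - 1 = m := by omega
      have : -(x θ ^ (2 * (m + 1) - 1) * U (x θ))
          - x θ ^ (m + 1 - 1) * W (x θ) * v θ + v θ ^ 2 * K (x θ, v θ)
          = -((ρ θ ^ m) ^ 2 * ρ θ * polarB (m + 1) U W K θ (ρ θ)) := by
        simp only [polarB, e1, e2, x, v]
        ring
      rw [this]
      refine Eq.trans ?_ i2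
      simp only [polarR, Q, x, v, e2, Pi.pow_apply]
      ring
    have dy := (hFx.hasDerivAt.comp θ dx).add dv
    refine (dx.prodMk dy).congr_deriv ?_
    have n1' : F (x θ) + v θ + X (x θ, F (x θ) + v θ) = v θ * h (x θ, v θ) := n1
    have n2' : Y (x θ, F (x θ) + v θ) = deriv F (x θ) * (v θ * h (x θ, v θ))
          + (-(x θ ^ (2 * (m + 1) - 1) * U (x θ)) - x θ ^ (m + 1 - 1) * W (x θ) * v θ
            + v θ ^ 2 * K (x θ, v θ)) := n2
    ext
    · simp only [Prod.smul_mk, smul_eq_mul, n1']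
    · simp only [Prod.smul_mk, smul_eq_mul, n2']
      ring

theorem first_return_time_unique {γ c : ℝ → ℝ × ℝ} {T : ℝ → ℝ} {L τ : ℝ} {R : ℝ × ℝ → Prop}
    (hTc : Continuous T) (hTm : StrictMono T) (hT0 : T 0 = 0)
    (hT : ∀ θ ∈ Icc 0 L, γ (T θ) = c θ) (hL : 0 < L) (hτ : 0 < τ) (hτR : R (γ τ))
    (hτmin : ∀ t, 0 < t → t < τ → ¬R (γ t)) (hLR : R (c L))
    (hLmin : ∀ θ ∈ Ioo 0 L, ¬R (c θ)) : γ τ = c L := by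
  have hTL : γ (T L) = c L := hT L (right_mem_Icc.2 hL.le)
  rcases lt_trichotomy (T L) τ with h | h | h
  · exact absurd (hTL ▸ hLR) (hτmin _ (hT0 ▸ hTm hL) h)
  · rw [← h, hTL]
  · obtain ⟨θ, hθ, rfl⟩ := intermediate_value_Ioo hL.le hTc.continuousOn
      (show τ ∈ Ioo (T 0) (T L) from ⟨hT0.trans_lt hτ, h⟩)
    exact absurd (hT θ (Ioo_subset_Icc_self hθ) ▸ hτR) (hLmin θ hθ)

end PolarBlowUp

/-- **Theorem 1.4(1).**  For system (1.9) `x' = y + X(x,y,δ)`, `y' = Y(x,y,δ)`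
satisfying (1.11) and (1.12) for all `δ` in a compact set `D`, if `n` is odd then
there is a unique function `P̄(·,δ)`, analytic at `x₀ = 0` with `P̄(0,δ) = 0` and
`∂P̄/∂x₀(0,δ) > 0`, which agrees with the Poincaré return map `P(·,δ)` for all
small `|x₀|`; in particular `P(·,δ)` is analytic at `x₀ = 0`. -/
theorem poincare_map_analytic_of_odd
    (n mp : ℕ) (hn : 2 ≤ n) (hodd : Odd n)
    (D : Set (Fin mp → ℝ)) (hD : IsCompact D)
    (XX YY : ℝ → ℝ → (Fin mp → ℝ) → ℝ)
    (hXana : ∀ δ ∈ D, AnalyticAt ℝ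
      (fun p : ℝ × ℝ × (Fin mp → ℝ) => XX p.1 p.2.1 p.2.2) (0, 0, δ))
    (hYana : ∀ δ ∈ D, AnalyticAt ℝ
      (fun p : ℝ × ℝ × (Fin mp → ℝ) => YY p.1 p.2.1 p.2.2) (0, 0, δ))
    (hXsmall : ∀ δ ∈ D,
      (fun p : ℝ × ℝ => XX p.1 p.2 δ) =O[nhds (0 : ℝ × ℝ)] fun p => ‖p‖ ^ 2)
    (hYsmall : ∀ δ ∈ D,
      (fun p : ℝ × ℝ => YY p.1 p.2 δ) =O[nhds (0 : ℝ × ℝ)] fun p => ‖p‖ ^ 2)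
    -- `y = F(x,δ)` is the analytic solution of `y + X(x,y,δ) = 0`, `F(0,δ) = 0`
    (F : ℝ → (Fin mp → ℝ) → ℝ)
    (hFana : ∀ δ ∈ D, AnalyticAt ℝ (fun x => F x δ) 0)
    (hF0 : ∀ δ ∈ D, F 0 δ = 0)
    (hFsol : ∀ δ ∈ D, ∀ᶠ x in nhds (0 : ℝ), F x δ + XX x (F x δ) δ = 0)
    -- the functions (1.10)
    (g f : ℝ → (Fin mp → ℝ) → ℝ)
    (hgdef : ∀ δ ∈ D, ∀ x, g x δ = -YY x (F x δ) δ)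
    (hfdef : ∀ δ ∈ D, ∀ x, f x δ =
      -(deriv (fun s => XX s (F x δ) δ) x + deriv (fun s => YY x s δ) (F x δ)))
    -- condition (1.11)
    (a : (Fin mp → ℝ) → ℝ) (ha : ∀ δ ∈ D, 0 < a δ)
    (hg11 : ∀ δ ∈ D, ∃ u : ℝ → ℝ, AnalyticAt ℝ u 0 ∧ u 0 = a δ ∧
      ∀ᶠ x in nhds (0 : ℝ), g x δ = x ^ (2 * n - 1) * u x)
    -- condition (1.12)
    (b : (Fin mp → ℝ) → ℝ)
    (hf12 : ∀ δ ∈ D, ∃ w : ℝ → ℝ, AnalyticAt ℝ w 0 ∧ w 0 = b δ ∧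
      ∀ᶠ x in nhds (0 : ℝ), f x δ = x ^ (n - 1) * w x)
    (hb : ∀ δ ∈ D, (b δ) ^ 2 - 4 * n * a δ < 0)
    -- the Poincaré return map
    (P : ℝ → (Fin mp → ℝ) → ℝ)
    (hP0 : ∀ δ ∈ D, P 0 δ = 0)
    (hP : ∀ δ ∈ D, ∃ ε > 0, ∀ x₀ : ℝ, x₀ ≠ 0 → |x₀| < ε →
      ∃ γ : ℝ → ℝ × ℝ, γ 0 = (x₀, F x₀ δ) ∧
        (∀ t : ℝ,
          HasDerivAt (fun s => (γ s).1) ((γ t).2 + XX (γ t).1 (γ t).2 δ) t ∧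
          HasDerivAt (fun s => (γ s).2) (YY (γ t).1 (γ t).2 δ) t) ∧
        ∃ τ : ℝ, 0 < τ ∧
          ((γ τ).2 = F (γ τ).1 δ ∧ 0 < x₀ * (γ τ).1) ∧
          (∀ t : ℝ, 0 < t → t < τ →
            ¬((γ t).2 = F (γ t).1 δ ∧ 0 < x₀ * (γ t).1)) ∧
          P x₀ δ = (γ τ).1) :
    ∀ δ ∈ D,
      (∃ Pb : ℝ → ℝ,
        (AnalyticAt ℝ Pb 0 ∧ Pb 0 = 0 ∧ 0 < deriv Pb 0 ∧
          ∀ᶠ x₀ in nhds (0 : ℝ), P x₀ δ = Pb x₀) ∧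
        ∀ Pb' : ℝ → ℝ,
          (AnalyticAt ℝ Pb' 0 ∧ Pb' 0 = 0 ∧ 0 < deriv Pb' 0 ∧
            ∀ᶠ x₀ in nhds (0 : ℝ), P x₀ δ = Pb' x₀) →
          Pb' =ᶠ[nhds (0 : ℝ)] Pb) ∧
      AnalyticAt ℝ (fun x₀ => P x₀ δ) 0 := by
  intro δ hδ
  obtain ⟨u, hu, hu0, hgu⟩ := hg11 δ hδ
  obtain ⟨w, hw, hw0, hfw⟩ := hf12 δ hδ
  have hι : AnalyticAt ℝ (fun p : ℝ × ℝ => (p.1, p.2, δ)) 0 :=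
    analyticAt_fst.prod (analyticAt_snd.prod analyticAt_const)
  have hX : AnalyticAt ℝ (fun p : ℝ × ℝ => XX p.1 p.2 δ) 0 :=
    AnalyticAt.fun_comp (f := fun p : ℝ × ℝ => (p.1, p.2, δ)) (hXana δ hδ) hι
  have hY : AnalyticAt ℝ (fun p : ℝ × ℝ => YY p.1 p.2 δ) 0 :=
    AnalyticAt.fun_comp (f := fun p : ℝ × ℝ => (p.1, p.2, δ)) (hYana δ hδ) hι
  obtain ⟨Pb, hPb, hPb0, hPb', horb⟩ := exists_polar_orbit hn hodd hX hY (hFana δ hδ) hu hw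
    (hF0 δ hδ) (hXsmall δ hδ) (hFsol δ hδ) (hgu.mono fun x hx => (hgdef δ hδ x).symm.trans hx)
    (hfw.mono fun x hx => (hfdef δ hδ x).symm.trans hx) (by rw [hu0, hw0]; exact hb δ hδ)
  have hV : AnalyticAt ℝ (fun p : ℝ × ℝ => (p.2 + XX p.1 p.2 δ, YY p.1 p.2 δ)) 0 :=
    (analyticAt_snd.add hX).prod hY
  obtain ⟨k, S, hS, hlip⟩ := (hV.contDiffAt (n := 1)).exists_lipschitzOnWith
  obtain ⟨ε, hε, hεS⟩ := Metric.mem_nhds_iff.1 hS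
  obtain ⟨r, hr, hret⟩ := hP δ hδ
  have hPPb : ∀ᶠ z in nhds (0 : ℝ), P z δ = Pb z := by
    filter_upwards [horb ε hε, Metric.ball_mem_nhds (0 : ℝ) hr] with z hz hzr
    rcases eq_or_ne z 0 with rfl | hz0
    · rw [hP0 δ hδ, hPb0]
    obtain ⟨γ, hγ0, hγ, τ, hτ, hτr, hτmin, hPτ⟩ := hret z hz0 (by simpa using hzr)
    obtain ⟨c, κ, hκ, hκ0, hc0, hc1, hzPb, hcmin, hc⟩ := hz hz0
    obtain ⟨T, hTc, hTm, hT0, hT⟩ := exists_time_change (hlip.mono hεS) hκ hκ0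
      (fun t => (hγ t).1.prodMk (hγ t).2) hc (hγ0.trans hc0.symm)
    rw [hPτ, eq_comm, first_return_time_unique hTc hTm hT0 hT Real.two_pi_pos hτ
      (R := fun p => p.2 = F p.1 δ ∧ 0 < z * p.1) hτr hτmin (by simpa [hc1] using hzPb) hcmin, hc1]
  refine ⟨⟨Pb, ⟨hPb, hPb0, hPb', hPPb⟩, fun Q hQ => ?_⟩, hPb.congr (hPPb.mono fun _ => Eq.symm)⟩
  filter_upwards [hQ.2.2.2, hPPb] with z h1 h2
  rw [← h1, h2]
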